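/- arXiv:1601.06685 — 9 statements merged into one kernel-verified Lean document; each statement's English description precedes it below -/
import Mathlib

section
/- For all integers n ≥ 0 and 0 ≤ k ≤ n+1, the binomial coefficient C(n+k+1, k) satisfies C(n+k+1, k) = Σ_{s=0}^{min(n,k)} C(n,s)·2^{k−s}, where C(n,s) denotes the Catalan triangle number. -/
/-- The Catalan triangle numbers: `C(n,k) = (n+k)! (n-k+1) / (k! (n+1)!)`,
which vanishes for `k > n` (by truncated subtraction). -/
def catalanTriangle (n k : ℕ) : ℕ :=
  (n + k).factorial * (n + 1 - k) / (k.factorial * (n + 1).factorial)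

theorem cat_succ (n k : ℕ) (hk : k ≤ n) :
    (n + k + 1).choose (k + 1) = catalanTriangle n (k + 1) + (n + k + 1).choose k := by
  obtain ⟨d, rfl⟩ := Nat.exists_eq_add_of_le hk
  have h1 := Nat.choose_mul_factorial_mul_factorial (n := k + d + k + 1) (k := k) (by omega)
  have h2 := Nat.choose_mul_factorial_mul_factorial (n := k + d + k + 1) (k := k + 1) (by omega)
  rw [show k + d + k + 1 - k = k + d + 1 by omega] at h1
  rw [show k + d + k + 1 - (k + 1) = k + d by omega] at h2
  have hle : (k + d + k + 1).choose k ≤ (k + d + k + 1).choose (k + 1) := by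
    have h3 := Nat.choose_succ_right_eq (k + d + k + 1) k
    rw [show k + d + k + 1 - k = k + d + 1 by omega] at h3
    by_contra! h
    nlinarith
  obtain ⟨e, he⟩ := Nat.exists_eq_add_of_le hle
  have hc : catalanTriangle (k + d) (k + 1) = e := by
    unfold catalanTriangle
    rw [show k + d + 1 - (k + 1) = d by omega, show k + d + (k + 1) = k + d + k + 1 by omega]
    apply Nat.div_eq_of_eq_mul_left (by positivity)
    rw [he] at h2
    generalize (k + d + k + 1).choose k = a at *
    generalize (k + d + k + 1).factorial = N at *
    rw [Nat.factorial_succ] at h1 h2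
    rw [Nat.factorial_succ, Nat.factorial_succ]
    zify at *
    linear_combination (k + 1 : ℤ) * h1 - (k + d + 1 : ℤ) * h2
  rw [hc, he]; ring

theorem cat_aux (n k : ℕ) (hk : k ≤ n + 1) :
    (n + k + 1).choose k =
      ∑ s ∈ Finset.range (k + 1), catalanTriangle n s * 2 ^ (k - s) := by
  induction k with
  | zero =>
    have : catalanTriangle n 0 = 1 := by
      unfold catalanTriangle
      apply Nat.div_eq_of_eq_mul_left (by positivity)
      simp [Nat.factorial_succ, mul_comm]
    simp [this]
  | succ k ih =>
    have h := cat_succ n k (by omega)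
    have ih := ih (by omega)
    rw [Finset.sum_range_succ]
    have : ∑ s ∈ Finset.range (k + 1), catalanTriangle n s * 2 ^ (k + 1 - s)
        = 2 * ∑ s ∈ Finset.range (k + 1), catalanTriangle n s * 2 ^ (k - s) := by
      rw [Finset.mul_sum]
      refine Finset.sum_congr rfl fun s hs => ?_
      rw [Finset.mem_range] at hs
      rw [show k + 1 - s = (k - s) + 1 by omega, pow_succ]
      ring
    rw [this, ← ih, show n + (k + 1) + 1 = (n + k + 1) + 1 by omega, Nat.choose_succ_succ, h]
    simp
    ring

theorem stmt_0 (n k : ℕ) (hk : k ≤ n + 1) :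
    (n + k + 1).choose k =
      ∑ s ∈ Finset.range (min n k + 1), catalanTriangle n s * 2 ^ (k - s) := by
  rw [cat_aux n k hk]
  rcases Nat.lt_or_ge n k with h | h
  · obtain rfl : k = n + 1 := by omega
    rw [Finset.sum_range_succ, show min n (n + 1) = n by omega]
    simp [catalanTriangle]
  · rw [min_eq_right h]
end

section
/- For all integers n ≥ 0 and 1 ≤ k ≤ n+1, the binomial coefficient C(n+1+k, k) satisfies C(n+1+k, k) = Σ_{s=0}^{k} C(n+1,s)·2^{max(k−1−s, 0)}, where C(n+1,s) denotes the Catalan triangle number. -/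
theorem catTri_zero (N : ℕ) : catalanTriangle N 0 = 1 := by
  unfold catalanTriangle
  have : N.factorial * (N + 1) = (N + 1).factorial := by
    rw [Nat.factorial_succ, mul_comm]
  simp only [add_zero, Nat.sub_zero, Nat.factorial_zero, one_mul, this]
  exact Nat.div_self (Nat.factorial_pos _)

theorem catTri_succ (N s : ℕ) (h : s ≤ N) :
    catalanTriangle N (s + 1) + (N + s + 1).choose s = (N + s + 1).choose (s + 1) := by
  have h1 : (N + s + 1).choose (s + 1) * (s + 1).factorial * N.factorial
      = (N + s + 1).factorial := by
    have := Nat.choose_mul_factorial_mul_factorial (show s + 1 ≤ N + s + 1 by omega)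
    rwa [show N + s + 1 - (s + 1) = N by omega] at this
  have h2 : (N + s + 1).choose s * s.factorial * (N + 1).factorial
      = (N + s + 1).factorial := by
    have := Nat.choose_mul_factorial_mul_factorial (show s ≤ N + s + 1 by omega)
    rwa [show N + s + 1 - s = N + 1 by omega] at this
  have hle : (N + s + 1).choose s ≤ (N + s + 1).choose (s + 1) := by
    have h3 := Nat.choose_succ_right_eq (N + s + 1) s
    rw [show N + s + 1 - s = N + 1 by omega] at h3
    have : (N + s + 1).choose s * (s + 1) ≤ (N + s + 1).choose (s + 1) * (s + 1) := by
      rw [h3]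
      exact Nat.mul_le_mul_left _ (by omega)
    exact Nat.le_of_mul_le_mul_right this (by omega)
  obtain ⟨d, hd⟩ := Nat.exists_eq_add_of_le hle
  obtain ⟨m, rfl⟩ := Nat.exists_eq_add_of_le h
  have key : catalanTriangle (s + m) (s + 1) = d := by
    unfold catalanTriangle
    apply Nat.div_eq_of_eq_mul_left
      (Nat.mul_pos (Nat.factorial_pos _) (Nat.factorial_pos _))
    rw [show s + m + 1 - (s + 1) = m by omega, ← add_assoc]
    rw [hd] at h1
    rw [Nat.factorial_succ s, Nat.factorial_succ (s + m)] at *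
    zify at *
    linear_combination (-(s + m + 1 : ℤ)) * h1 + (s + 1 : ℤ) * h2
  omega

theorem catTri_sum (N k : ℕ) (hk : k ≤ N) :
    (N + (k + 1)).choose (k + 1) =
      ∑ s ∈ Finset.range (k + 1 + 1), catalanTriangle N s * 2 ^ (k - s) := by
  induction k with
  | zero =>
    have := catTri_succ N 0 (by omega)
    simp [Finset.sum_range_succ, catTri_zero] at *
    omega
  | succ k ih =>
    have ih := ih (by omega)
    have e1 := catTri_succ N k (by omega)
    have e2 := catTri_succ N (k + 1) (by omega)
    have p := Nat.choose_succ_succ (N + k + 1) k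
    have e3 : ∑ s ∈ Finset.range (k + 1), catalanTriangle N s * 2 ^ (k + 1 - s)
        = 2 * ∑ s ∈ Finset.range (k + 1), catalanTriangle N s * 2 ^ (k - s) := by
      rw [Finset.mul_sum]
      apply Finset.sum_congr rfl
      intro s hs
      rw [Finset.mem_range] at hs
      rw [show k + 1 - s = (k - s) + 1 by omega, pow_succ]
      ring
    rw [Finset.sum_range_succ] at ih
    rw [Finset.sum_range_succ, Finset.sum_range_succ, e3]
    rw [show k - (k + 1) = 0 by omega] at ih
    rw [show k + 1 - (k + 1) = 0 by omega, show k + 1 - (k + 1 + 1) = 0 by omega]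
    simp only [pow_zero, mul_one, Nat.succ_eq_add_one, ← add_assoc] at *
    have p' := Nat.choose_succ_succ' (N + k + 1) k
    have e4 : catalanTriangle N (k + 2) = catalanTriangle N (k + 1 + 1) := rfl
    omega

theorem stmt_1 (n k : ℕ) (hk1 : 1 ≤ k) (hk2 : k ≤ n + 1) :
    (n + 1 + k).choose k =
      ∑ s ∈ Finset.range (k + 1), catalanTriangle (n + 1) s * 2 ^ (k - 1 - s) := by
  obtain ⟨j, rfl⟩ := Nat.exists_eq_add_of_le' hk1
  simpa using catTri_sum (n + 1) j (by omega)
end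

section
/- For every integer n ≥ 0, the binomial coefficient C(n+1, ⌈(n+1)/2⌉) satisfies C(n+1, ⌈(n+1)/2⌉) = Σ_{s=0}^{⌈n/2⌉} C(⌈n/2⌉, s)·2^{max(⌊n/2⌋−s, 0)}, where C(⌈n/2⌉, s) denotes the Catalan triangle number. -/
theorem ct_zero (m : ℕ) : catalanTriangle m 0 = 1 := by
  have h : (m + 1).factorial = m.factorial * (m + 1) := by
    rw [Nat.factorial_succ, mul_comm]
  simp [catalanTriangle, ← h, Nat.div_self (Nat.factorial_pos _)]

theorem ct_succ (m k : ℕ) (hk : k ≤ m) :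
    catalanTriangle m (k + 1) + (m + k + 1).choose k = (m + k + 1).choose (k + 1) := by
  obtain ⟨d, rfl⟩ := Nat.exists_eq_add_of_le hk
  have h1 := Nat.choose_mul_factorial_mul_factorial (n := k + d + k + 1) (k := k) (by omega)
  have h2 := Nat.choose_mul_factorial_mul_factorial (n := k + d + k + 1) (k := k + 1) (by omega)
  rw [show k + d + k + 1 - k = k + d + 1 by omega] at h1
  rw [show k + d + k + 1 - (k + 1) = k + d by omega] at h2
  have hpos : 0 < (k + 1).factorial * (k + d + 1).factorial := by positivity
  unfold catalanTriangle
  rw [show k + d + 1 - (k + 1) = d by omega, ← Nat.add_mul_div_right _ _ hpos]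
  apply Nat.div_eq_of_eq_mul_left hpos
  rw [show k + d + (k + 1) = k + d + k + 1 by omega]
  have e1 : (k + 1).factorial = (k + 1) * k.factorial := Nat.factorial_succ k
  have e2 : (k + d + 1).factorial = (k + d + 1) * (k + d).factorial := Nat.factorial_succ _
  calc _ = (k + d + k + 1).factorial * d + (k + 1) * ((k + d + k + 1).choose k * k.factorial * (k + d + 1).factorial) := by
        rw [e1]; ring
    _ = (k + d + 1) * (k + d + k + 1).factorial := by rw [h1]; ring
    _ = _ := by rw [← h2, e2]; ring

theorem ct_sum (m k : ℕ) (hk : k ≤ m) :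
    ∑ s ∈ Finset.range (k + 1), catalanTriangle m s * 2 ^ (k - s) = (m + k + 1).choose k := by
  induction k with
  | zero => simp [ct_zero]
  | succ k ih =>
    rw [Finset.sum_range_succ]
    have : ∑ s ∈ Finset.range (k + 1), catalanTriangle m s * 2 ^ (k + 1 - s)
        = 2 * (m + k + 1).choose k := by
      rw [← ih (by omega), Finset.mul_sum]
      refine Finset.sum_congr rfl fun s hs => ?_
      have := Finset.mem_range.1 hs
      rw [show k + 1 - s = (k - s) + 1 by omega, pow_succ]; ring
    have h := ct_succ m k (by omega)
    have hp : (m + (k + 1) + 1).choose (k + 1) = (m + k + 1).choose k + (m + k + 1).choose (k + 1) :=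
      Nat.choose_succ_succ _ _
    rw [this, hp, Nat.sub_self, pow_zero]
    omega

theorem stmt_2 (n : ℕ) :
    (n + 1).choose ((n + 2) / 2) =
      ∑ s ∈ Finset.range ((n + 1) / 2 + 1),
        catalanTriangle ((n + 1) / 2) s * 2 ^ (n / 2 - s) := by
  obtain ⟨m, h | h⟩ := Nat.even_or_odd' n
  · subst h
    rw [show (2 * m + 1) / 2 = m by omega, show 2 * m / 2 = m by omega,
      show (2 * m + 2) / 2 = m + 1 by omega, ct_sum m m le_rfl,
      show m + m + 1 = 2 * m + 1 by omega]
    exact Nat.choose_symm_of_eq_add (by omega)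
  · subst h
    rw [show (2 * m + 1 + 1) / 2 = m + 1 by omega, show (2 * m + 1) / 2 = m by omega,
      show (2 * m + 1 + 2) / 2 = m + 1 by omega, Finset.sum_range_succ,
      ct_sum (m + 1) m (by omega)]
    have h := ct_succ (m + 1) m (by omega)
    rw [show m + 1 + m + 1 = 2 * m + 1 + 1 by omega] at *
    rw [show m - (m + 1) = 0 by omega, pow_zero]
    omega
end

section
/- For all integers n, k, m with n > k ≥ m ≥ 1, the binomial coefficient binom(n+k+1, k) satisfies binom(n+k+1, k) = Σ_{s=0}^{k−m} C(n+m, s)·2^{k−m−s} + Σ_{t=1}^{m} A(m,t)·C(n+m, k−m+t), where C denotes the Catalan triangle number and A denotes the alternating Jacobsthal triangle number. -/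
/-- The alternating Jacobsthal triangle numbers: `A(m,0) = 1`,
`A(m,t) = A(m-1,t-1) - A(m-1,t)` for `m ≥ t ≥ 1`, and `A(m,t) = 0` for `t > m`. -/
def altJacobsthal : ℕ → ℕ → ℤ
  | _, 0 => 1
  | 0, _ + 1 => 0
  | m + 1, t + 1 => altJacobsthal m t - altJacobsthal m (t + 1)

def cT (n : ℕ) : ℕ → ℤ
  | 0 => 1
  | s + 1 => ((n + s + 1).choose (s + 1) : ℤ) - ((n + s + 1).choose s : ℤ)

theorem cT_rec (N s : ℕ) : cT N (s + 1) = cT (N + 1) (s + 1) - cT (N + 1) s := by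
  cases s with
  | zero => simp [cT]
  | succ s =>
    have h1 := Nat.choose_succ_succ (N + s + 2) (s + 1)
    have h2 := Nat.choose_succ_succ (N + s + 2) s
    simp only [cT]
    rw [show N + 1 + (s + 1) + 1 = N + s + 2 + 1 by ring, show N + 1 + s + 1 = N + s + 2 by ring,
      show N + (s + 1) + 1 = N + s + 2 by ring]
    simp only [Nat.succ_eq_add_one] at h1 h2
    rw [h1, h2]
    push_cast
    ring

theorem cT_eq (n s : ℕ) (h : s ≤ n) : (catalanTriangle n s : ℤ) = cT n s := by
  cases s with
  | zero =>
    have : catalanTriangle n 0 = 1 := by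
      unfold catalanTriangle
      simp only [add_zero, Nat.sub_zero, Nat.factorial_zero, one_mul]
      rw [mul_comm, ← Nat.factorial_succ]
      exact Nat.div_self (Nat.factorial_pos _)
    simp [this, cT]
  | succ s =>
    have e1 : ((n + s + 1).choose (s + 1)) * (s + 1).factorial * n.factorial
        = (n + s + 1).factorial := by
      have := Nat.choose_mul_factorial_mul_factorial (n := n + s + 1) (k := s + 1) (by omega)
      rwa [show n + s + 1 - (s + 1) = n by omega] at this
    have e2 : ((n + s + 1).choose s) * s.factorial * (n + 1).factorial
        = (n + s + 1).factorial := by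
      have := Nat.choose_mul_factorial_mul_factorial (n := n + s + 1) (k := s) (by omega)
      rwa [show n + s + 1 - s = n + 1 by omega] at this
    obtain ⟨d, rfl⟩ : ∃ d, n = s + 1 + d := ⟨n - (s + 1), by omega⟩
    have key : (s + 1 + d + (s + 1)).factorial * (s + 1 + d + 1 - (s + 1)) +
        (s + 1 + d + s + 1).choose s * ((s + 1).factorial * (s + 1 + d + 1).factorial)
        = (s + 1 + d + s + 1).choose (s + 1) * ((s + 1).factorial * (s + 1 + d + 1).factorial) := by
      rw [show s + 1 + d + 1 - (s + 1) = d + 1 by omega,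
        show s + 1 + d + (s + 1) = s + 1 + d + s + 1 by ring]
      have a1 := Nat.factorial_succ s
      have a2 := Nat.factorial_succ (s + 1 + d)
      calc _ = (s + 1 + d + s + 1).factorial * (d + 1) + (s + 1) *
            ((s + 1 + d + s + 1).choose s * s.factorial * (s + 1 + d + 1).factorial) := by
              rw [a1]; ring
        _ = (s + 1 + d + 1) *
          ((s + 1 + d + s + 1).choose (s + 1) * (s + 1).factorial * (s + 1 + d).factorial) := by
              rw [e1, e2]; ring
        _ = _ := by rw [a2]; ring
    have hp : 0 < (s + 1).factorial * (s + 1 + d + 1).factorial := by positivity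
    have : catalanTriangle (s + 1 + d) (s + 1) =
        (s + 1 + d + s + 1).choose (s + 1) - (s + 1 + d + s + 1).choose s := by
      unfold catalanTriangle
      apply Nat.div_eq_of_eq_mul_left hp
      rw [Nat.sub_mul]
      omega
    have hle : (s + 1 + d + s + 1).choose s ≤ (s + 1 + d + s + 1).choose (s + 1) := by
      apply Nat.le_of_mul_le_mul_right _ hp
      omega
    rw [this, Nat.cast_sub hle]
    rfl

def sT (N K : ℕ) : ℤ := ∑ s ∈ Finset.range (K + 1), cT N s * 2 ^ (K - s)

theorem sT_succ (N K : ℕ) : sT N (K + 1) = 2 * sT N K + cT N (K + 1) := by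
  unfold sT
  rw [Finset.sum_range_succ, Finset.mul_sum]
  congr 1
  · apply Finset.sum_congr rfl
    intro s hs
    have := Finset.mem_range.1 hs
    rw [show K + 1 - s = K - s + 1 by omega]
    ring
  · simp

theorem sT_zero (N : ℕ) : sT N 0 = 1 := by simp [sT, cT]

theorem sT_step (N K : ℕ) : sT N (K + 1) = cT (N + 1) (K + 1) + sT (N + 1) K := by
  induction K with
  | zero => rw [sT_succ, sT_zero, sT_zero, cT_rec]; simp [cT]; ring
  | succ K ih => rw [sT_succ, ih, sT_succ, cT_rec N (K + 1)]; ring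

theorem sT_choose (n k : ℕ) : ((n + k + 1).choose k : ℤ) = sT n k := by
  induction k with
  | zero => simp [sT_zero]
  | succ k ih =>
    rw [sT_succ, ← ih, cT, show n + (k + 1) + 1 = n + k + 1 + 1 by ring, Nat.choose_succ_succ]
    push_cast
    simp only [Nat.succ_eq_add_one]
    ring

theorem altJ_zero (m : ℕ) : altJacobsthal m 0 = 1 := by cases m <;> rfl

theorem altJ_gt (m : ℕ) : ∀ t, m < t → altJacobsthal m t = 0 := by
  induction m with
  | zero => intro t ht; cases t with
    | zero => omega
    | succ t => rfl
  | succ m ih => intro t ht; cases t with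
    | zero => omega
    | succ t => rw [altJacobsthal, ih t (by omega), ih (t + 1) (by omega)]; rfl

theorem main_aux (n m : ℕ) : ∀ K, ((n + (K + m) + 1).choose (K + m) : ℤ) =
    sT (n + m) K + ∑ t ∈ Finset.range m, altJacobsthal m (t + 1) * cT (n + m) (K + t + 1) := by
  induction m with
  | zero => intro K; simpa using sT_choose n K
  | succ m ih =>
    intro K
    have h := ih (K + 1)
    rw [show K + 1 + m = K + (m + 1) by ring] at h
    rw [h, sT_step]
    have e1 : ∑ t ∈ Finset.range (m + 1), altJacobsthal m t * cT (n + m + 1) (K + t + 1)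
      = ∑ t ∈ Finset.range m, altJacobsthal m (t + 1) * cT (n + m + 1) (K + 1 + t + 1)
        + cT (n + m + 1) (K + 1) := by
      rw [Finset.sum_range_succ', altJ_zero, one_mul]
      congr 1
      apply Finset.sum_congr rfl
      intro t _
      rw [show K + (t + 1) + 1 = K + 1 + t + 1 by ring]
    have e2 : ∑ t ∈ Finset.range (m + 1), altJacobsthal m (t + 1) * cT (n + m + 1) (K + t + 1)
      = ∑ t ∈ Finset.range m, altJacobsthal m (t + 1) * cT (n + m + 1) (K + 1 + t) := by
      rw [Finset.sum_range_succ, altJ_gt m (m + 1) (by omega), zero_mul, add_zero]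
      apply Finset.sum_congr rfl
      intro t _
      rw [show K + t + 1 = K + 1 + t by ring]
    simp only [altJacobsthal, sub_mul, Finset.sum_sub_distrib, cT_rec (n + m), mul_sub]
    rw [← add_assoc n m 1, e1, e2]
    ring

theorem stmt_8 (n k m : ℕ) (hm : 1 ≤ m) (hmk : m ≤ k) (hkn : k < n) :
    ((n + k + 1).choose k : ℤ) =
      (∑ s ∈ Finset.range (k - m + 1),
        (catalanTriangle (n + m) s : ℤ) * 2 ^ (k - m - s)) +
      ∑ t ∈ Finset.Icc 1 m,
        altJacobsthal m t * (catalanTriangle (n + m) (k - m + t) : ℤ) := by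
  have h := main_aux n m (k - m)
  rw [Nat.sub_add_cancel hmk] at h
  rw [h, sT]
  congr 1
  · apply Finset.sum_congr rfl
    intro s hs
    have := Finset.mem_range.1 hs
    rw [cT_eq _ _ (by omega)]
  · rw [Finset.range_eq_Ico]
    refine (Finset.sum_Ico_add' (fun t => altJacobsthal m t * cT (n + m) (k - m + t)) 0 m 1).trans ?_
    apply Finset.sum_congr (by ext; simp <;> omega)
    intro t ht
    have := Finset.mem_Icc.1 ht
    rw [cT_eq _ _ (by omega)]
end

section
/- For all integers n > k ≥ 0, the binomial coefficient binom(n+k+1, k) satisfies binom(n+k+1, k) = Σ_{t=0}^{k} A(k,t)·C(n+k, t), where C denotes the Catalan triangle number and A denotes the alternating Jacobsthal triangle number. -/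
theorem aj_zero_of_lt : ∀ k t : ℕ, k < t → altJacobsthal k t = 0
  | _, 0, h => by omega
  | 0, t + 1, _ => by simp [altJacobsthal]
  | k + 1, t + 1, h => by
    rw [altJacobsthal, aj_zero_of_lt k t (by omega), aj_zero_of_lt k (t + 1) (by omega)]
    rfl

theorem aj_left_zero (k : ℕ) : altJacobsthal k 0 = 1 := by
  cases k <;> simp [altJacobsthal]

def ajL (k : ℕ) (h : ℕ → ℤ) : ℤ := ∑ t ∈ Finset.range (k + 1), altJacobsthal k t * h t

theorem ajL_succ (k : ℕ) (h : ℕ → ℤ) :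
    ajL (k + 1) h = 2 * h 0 + ajL k (fun t => h (t + 1)) - ajL k h := by
  have e : ajL k h = ∑ t ∈ Finset.range (k + 1), altJacobsthal k (t + 1) * h (t + 1) + h 0 := by
    have : ajL k h = ∑ t ∈ Finset.range (k + 2), altJacobsthal k t * h t := by
      rw [Finset.sum_range_succ, aj_zero_of_lt k (k + 1) (by omega)]
      simp [ajL]
    rw [this, Finset.sum_range_succ', aj_left_zero, one_mul]
  rw [e]
  unfold ajL
  rw [Finset.sum_range_succ']
  simp only [altJacobsthal, sub_mul, Finset.sum_sub_distrib]
  ring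

theorem ajL_add (k : ℕ) (f g : ℕ → ℤ) : ajL k (fun t => f t + g t) = ajL k f + ajL k g := by
  simp [ajL, mul_add, Finset.sum_add_distrib]

def ctD (N : ℕ) : ℕ → ℤ
  | 0 => 1
  | t + 1 => ((N + t + 1).choose (t + 1) : ℤ) - ((N + t + 1).choose t : ℤ)

theorem ctD_rec (N t : ℕ) : ctD (N + 1) (t + 1) = ctD (N + 1) t + ctD N (t + 1) := by
  cases t with
  | zero => simp [ctD]; ring
  | succ t =>
    simp only [ctD]
    rw [show N + 1 + (t + 1) + 1 = (N + t + 2) + 1 by ring,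
      show N + 1 + t + 1 = N + t + 2 by ring, show N + (t + 1) + 1 = N + t + 2 by ring,
      Nat.choose_succ_succ (N + t + 2) (t + 1), Nat.choose_succ_succ (N + t + 2) t]
    push_cast
    simp only [Nat.succ_eq_add_one]
    ring

theorem ctD_zero (t : ℕ) : ctD 0 t = 1 - t := by
  cases t with
  | zero => simp [ctD]
  | succ t => simp [ctD, Nat.choose_succ_self_right]

theorem ajL_one (k : ℕ) : ajL (k + 1) (fun _ => 1) = 2 := by
  rw [ajL_succ]; ring

theorem ajL_base (k : ℕ) : ajL k (ctD 0) = ((1 : ℕ).choose k : ℤ) := by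
  have hf : ctD 0 = fun t : ℕ => (1 : ℤ) - t := funext ctD_zero
  rw [hf]
  match k with
  | 0 => simp [ajL, altJacobsthal]
  | 1 => simp [ajL, altJacobsthal, Finset.sum_range_succ]
  | k + 2 =>
    rw [ajL_succ]
    have := ajL_add (k + 1) (fun t : ℕ => (1 : ℤ) - ((t + 1 : ℕ) : ℤ)) (fun _ => 1)
    rw [ajL_one] at this
    have e : (fun t : ℕ => (1 : ℤ) - ((t + 1 : ℕ) : ℤ) + 1) = fun t : ℕ => (1 : ℤ) - t := by
      funext t; push_cast; ring
    rw [e] at this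
    rw [this, Nat.choose_eq_zero_of_lt (by omega)]
    push_cast
    ring

theorem ajL_main (k N : ℕ) : ajL k (ctD N) = ((N + 1).choose k : ℤ) := by
  induction k generalizing N with
  | zero => simp [ajL, altJacobsthal, ctD]
  | succ k ih =>
    induction N with
    | zero => exact ajL_base _
    | succ N ihN =>
      rw [ajL_succ] at ihN ⊢
      have e : (fun t => ctD (N + 1) (t + 1)) = fun t => ctD (N + 1) t + ctD N (t + 1) :=
        funext (ctD_rec N)
      rw [e, ajL_add, Nat.choose_succ_succ, Nat.cast_add, ← ih N]
      have h0 : ∀ M, ctD M 0 = 1 := fun M => rfl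
      rw [h0] at ihN ⊢
      change _ = _ + (((N + 1).choose (k + 1) : ℕ) : ℤ)
      rw [← ihN]
      change 2 * 1 + (ajL k (ctD (N + 1)) + _) - _ = _
      ring

theorem ct_eq (N t : ℕ) (h : t ≤ N) : (catalanTriangle N t : ℤ) = ctD N t := by
  cases t with
  | zero =>
    have : catalanTriangle N 0 = 1 := by
      unfold catalanTriangle
      simp only [add_zero, Nat.sub_zero, Nat.factorial_zero, one_mul]
      rw [Nat.factorial_succ, mul_comm]
      exact Nat.div_self (by positivity)
    simp [this, ctD]
  | succ t =>
    have h1 := Nat.choose_mul_factorial_mul_factorial (show t + 1 ≤ N + t + 1 by omega)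
    have h2 := Nat.choose_mul_factorial_mul_factorial (show t ≤ N + t + 1 by omega)
    rw [show N + t + 1 - (t + 1) = N by omega] at h1
    rw [show N + t + 1 - t = N + 1 by omega] at h2
    unfold catalanTriangle
    have hc : ((N - t : ℕ) : ℤ) = N - t := by omega
    push_cast [Int.natCast_div]
    rw [hc]
    have hp : (0 : ℤ) < ((t + 1).factorial : ℤ) * ((N + 1).factorial : ℤ) := by positivity
    apply Int.ediv_eq_of_eq_mul_left hp.ne'
    rw [← add_assoc]
    simp only [ctD, Nat.factorial_succ t, Nat.factorial_succ N] at h1 h2 ⊢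
    zify at h1 h2
    push_cast
    linear_combination (-(N : ℤ) - 1) * h1 + ((t : ℤ) + 1) * h2

theorem stmt_9 (n k : ℕ) (hkn : k < n) :
    ((n + k + 1).choose k : ℤ) =
      ∑ t ∈ Finset.range (k + 1),
        altJacobsthal k t * (catalanTriangle (n + k) t : ℤ) := by
  have h := ajL_main k (n + k)
  rw [← h]
  unfold ajL
  refine Finset.sum_congr rfl fun t ht => ?_
  rw [ct_eq (n + k) t (by have := Finset.mem_range.mp ht; omega)]
end

section
/- Define B(m,t) = A(m, m−t) for integers m ≥ t ≥ 0, where A denotes the alternating Jacobsthal triangle number. Then for all integers m ≥ t ≥ 1 one has B(m,t) = 1 − Σ_{k=t}^{m−1} B(k, t−1); equivalently, A(m, m−t) = 1 − Σ_{k=t}^{m−1} A(k, k−t+1). -/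
theorem stmt_13 (m t : ℕ) (ht : 1 ≤ t) (htm : t ≤ m) :
    altJacobsthal m (m - t) =
      1 - ∑ k ∈ Finset.Icc t (m - 1), altJacobsthal k (k - (t - 1)) := by
  obtain ⟨s, rfl⟩ : ∃ s, t = s + 1 := ⟨t - 1, by omega⟩
  induction m, htm using Nat.le_induction with
  | base => simp [altJacobsthal]
  | succ n hn ih =>
    obtain ⟨d, rfl⟩ : ∃ d, n = s + 1 + d := ⟨n - (s + 1), by omega⟩
    have e1 : s + 1 + d + 1 - (s + 1) = d + 1 := by omega
    have e2 : s + 1 + d - (s + 1) = d := by omega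
    have e3 : s + 1 + d + 1 - 1 = (s + 1 + d - 1) + 1 := by omega
    have e4 : s + 1 + d - 1 + 1 = s + 1 + d := by omega
    have e5 : s + 1 + d - (s + 1 - 1) = d + 1 := by omega
    rw [e2] at ih
    rw [e1, altJacobsthal, ih, e3, Finset.sum_Icc_succ_top (by omega), e4, e5]
    ring
end

section
/- The alternating Jacobsthal triangle numbers near the diagonal have the closed forms: for every integer n ≥ 1, A(n, n−1) = 2 − n (as integers); for every integer n ≥ 2, 2·A(n, n−2) = 8 + n·(n−5); and for every integer n ≥ 3, 6·A(n, n−3) = 48 − n·(n² − 9n + 32). -/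
theorem aJ_diag (n : ℕ) : (∀ k, altJacobsthal n (n + k + 1) = 0) ∧ altJacobsthal n n = 1 := by
  induction n with
  | zero => exact ⟨fun k => by simp [altJacobsthal], by simp [altJacobsthal]⟩
  | succ m ih =>
    refine ⟨fun k => ?_, ?_⟩
    · have h1 := ih.1 k
      have h2 := ih.1 (k + 1)
      rw [show m + 1 + k + 1 = (m + k + 1) + 1 by omega, altJacobsthal, h1,
        show m + k + 1 + 1 = m + (k + 1) + 1 by omega, h2]
      rfl
    · have h1 := ih.1 0
      rw [altJacobsthal, ih.2, show m + 1 = m + 0 + 1 by omega, h1]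
      rfl

theorem aJ_one (t : ℕ) : altJacobsthal (t + 1) t = 1 - (t : ℤ) := by
  induction t with
  | zero => simp [altJacobsthal]
  | succ m ih =>
    rw [altJacobsthal, ih, (aJ_diag (m + 1)).2]
    push_cast; ring

theorem aJ_two (t : ℕ) : 2 * altJacobsthal (t + 2) t = 8 + ((t : ℤ) + 2) * ((t : ℤ) - 3) := by
  induction t with
  | zero => simp [altJacobsthal]
  | succ m ih =>
    have h := aJ_one (m + 1)
    rw [show m + 1 + 2 = (m + 2) + 1 by omega, altJacobsthal, mul_sub, ih, h]
    push_cast; ring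

theorem aJ_three (t : ℕ) : 6 * altJacobsthal (t + 3) t =
    48 - ((t : ℤ) + 3) * (((t : ℤ) + 3) ^ 2 - 9 * ((t : ℤ) + 3) + 32) := by
  induction t with
  | zero => simp [altJacobsthal]
  | succ m ih =>
    have h := aJ_two (m + 1)
    rw [show m + 1 + 3 = (m + 3) + 1 by omega, altJacobsthal]
    rw [show m + 1 + 2 = m + 3 by omega] at h
    push_cast at h ⊢
    linear_combination ih - 3 * h

theorem stmt_14 :
    (∀ n : ℕ, 1 ≤ n → altJacobsthal n (n - 1) = 2 - (n : ℤ)) ∧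
    (∀ n : ℕ, 2 ≤ n → 2 * altJacobsthal n (n - 2) = 8 + (n : ℤ) * ((n : ℤ) - 5)) ∧
    (∀ n : ℕ, 3 ≤ n →
      6 * altJacobsthal n (n - 3) = 48 - (n : ℤ) * ((n : ℤ) ^ 2 - 9 * (n : ℤ) + 32)) := by
  refine ⟨fun n hn => ?_, fun n hn => ?_, fun n hn => ?_⟩
  · obtain ⟨t, rfl⟩ := Nat.exists_eq_add_of_le' hn
    rw [Nat.add_sub_cancel, aJ_one]; push_cast; ring
  · obtain ⟨t, rfl⟩ := Nat.exists_eq_add_of_le' hn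
    rw [Nat.add_sub_cancel, aJ_two]; push_cast; ring
  · obtain ⟨t, rfl⟩ := Nat.exists_eq_add_of_le' hn
    rw [Nat.add_sub_cancel, aJ_three]; push_cast; ring
end

section
/- For every integer s ≥ 0, the diagonal sum B_s = Σ_{t=1}^{s+1} A(s+2−t, t) of the alternating Jacobsthal triangle (the sum of all A(m,t) with t + m − 2 = s and t > 0, using A(m,t)=0 for t > m) satisfies B_s = Σ_{k=1}^{s+1} (−1)^{k−1}·Fib(k) = 1 + (−1)^s·Fib(s), where Fib denotes the Fibonacci sequence with Fib(0)=0, Fib(1)=1, Fib(n+2)=Fib(n+1)+Fib(n). -/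
theorem aJ_rec (s : ℕ) :
    (∑ i ∈ Finset.range (s + 3), altJacobsthal (s + 3 - i) (i + 1)) =
      1 + (∑ i ∈ Finset.range (s + 1), altJacobsthal (s + 1 - i) (i + 1)) -
        ∑ i ∈ Finset.range (s + 2), altJacobsthal (s + 2 - i) (i + 1) := by
  have h1 : (∑ i ∈ Finset.range (s + 3), altJacobsthal (s + 3 - i) (i + 1)) =
      ∑ i ∈ Finset.range (s + 3),
        (altJacobsthal (s + 2 - i) i - altJacobsthal (s + 2 - i) (i + 1)) := by
    apply Finset.sum_congr rfl
    intro i hi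
    have hi' := Finset.mem_range.mp hi
    have h : s + 3 - i = (s + 2 - i) + 1 := by omega
    rw [h]
    simp [altJacobsthal]
  have h2 : ∀ i, s + 2 - (i + 1) = s + 1 - i := by intro i; omega
  rw [h1, Finset.sum_sub_distrib, Finset.sum_range_succ' (fun i => altJacobsthal (s + 2 - i) i),
    Finset.sum_range_succ (fun i => altJacobsthal (s + 2 - i) (i + 1))]
  simp only [h2]
  rw [Finset.sum_range_succ]
  simp [altJacobsthal]
  ring

theorem aJ_sum (s : ℕ) :
    (∑ i ∈ Finset.range (s + 1), altJacobsthal (s + 1 - i) (i + 1)) =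
      1 + (-1 : ℤ) ^ s * (Nat.fib s : ℤ) := by
  induction s using Nat.twoStepInduction with
  | zero => simp [altJacobsthal]
  | one => simp [Finset.sum_range_succ, altJacobsthal]
  | more n h1 h2 =>
    have h := aJ_rec n
    rw [h1, h2] at h
    rw [h, Nat.fib_add_two]
    push_cast
    ring

theorem fib_sum (s : ℕ) :
    ∑ k ∈ Finset.Icc 1 (s + 1), (-1 : ℤ) ^ (k - 1) * (Nat.fib k : ℤ) =
      1 + (-1 : ℤ) ^ s * (Nat.fib s : ℤ) := by
  induction s with
  | zero => simp
  | succ n ih =>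
    rw [Finset.sum_Icc_succ_top (by omega), ih, Nat.fib_add_two, Nat.add_sub_cancel]
    push_cast
    ring

theorem stmt_15 (s : ℕ) :
    (∑ t ∈ Finset.Icc 1 (s + 1), altJacobsthal (s + 2 - t) t) =
      ∑ k ∈ Finset.Icc 1 (s + 1), (-1 : ℤ) ^ (k - 1) * (Nat.fib k : ℤ) ∧
    (∑ t ∈ Finset.Icc 1 (s + 1), altJacobsthal (s + 2 - t) t) =
      1 + (-1 : ℤ) ^ s * (Nat.fib s : ℤ) := by
  have h : (∑ t ∈ Finset.Icc 1 (s + 1), altJacobsthal (s + 2 - t) t) =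
      1 + (-1 : ℤ) ^ s * (Nat.fib s : ℤ) := by
    rw [← aJ_sum, Finset.range_eq_Ico, ← Finset.Ico_add_one_right_eq_Icc,
      Finset.sum_Ico_eq_sum_range, ← Finset.range_eq_Ico]
    apply Finset.sum_congr (by simp)
    intro i _
    rw [show s + 2 - (1 + i) = s + 1 - i by omega, Nat.add_comm 1 i]
  exact ⟨h.trans (fib_sum s).symm, h⟩
end

section
/- For every integer s ≥ 0, define the polynomial B_s(q) = Σ_{t=1}^{⌊(s+2)/2⌋} A(s+2−t, t)·q^{s+2−2t} in ℤ[q], where A denotes the alternating Jacobsthal triangle number. Then in the formal power series ring (ℤ[q])[[x]] one has (1 − q·x)·(1 + q·x − x²)·(Σ_{s=0}^{∞} B_s(q)·x^s) = 1; that is, Σ_{s=0}^{∞} B_s(q)·x^s is the multiplicative inverse of (1−qx)(1+qx−x²). -/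
/-- The diagonal polynomial $B_s(q) = \sum_{t+m-2=s,\, t>0} A(m,t)\, q^{m-t}$
of the alternating Jacobsthal triangle. -/
noncomputable def diagPoly (s : ℕ) : Polynomial ℤ :=
  ∑ t ∈ Finset.Icc 1 ((s + 2) / 2),
    Polynomial.C (altJacobsthal (s + 2 - t) t) * Polynomial.X ^ (s + 2 - 2 * t)

theorem aj_zero (m t : ℕ) (h : m < t) : altJacobsthal m t = 0 := by
  induction m generalizing t with
  | zero =>
    cases t with
    | zero => omega
    | succ t => simp [altJacobsthal]
  | succ m ih =>
    cases t with
    | zero => omega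
    | succ t => rw [altJacobsthal, ih t (by omega), ih (t + 1) (by omega)]; simp

theorem diag_ext (s N : ℕ) (hN : (s + 2) / 2 ≤ N) :
    diagPoly s = ∑ k ∈ Finset.range N,
      Polynomial.C (altJacobsthal (s + 2 - (k + 1)) (k + 1)) *
        Polynomial.X ^ (s + 2 - 2 * (k + 1)) := by
  have h1 : diagPoly s = ∑ k ∈ Finset.range ((s + 2) / 2),
      Polynomial.C (altJacobsthal (s + 2 - (k + 1)) (k + 1)) *
        Polynomial.X ^ (s + 2 - 2 * (k + 1)) := by
    unfold diagPoly
    rw [Finset.range_eq_Ico, Finset.sum_Ico_add' (fun t => Polynomial.C (altJacobsthal (s + 2 - t) t) *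
        (Polynomial.X : Polynomial ℤ) ^ (s + 2 - 2 * t))]
    rfl
  rw [h1]
  apply Finset.sum_subset
  · intro k hk
    simp only [Finset.mem_range] at *
    omega
  · intro k _ hk
    simp only [Finset.mem_range] at hk
    rw [aj_zero _ _ (by omega)]
    simp

theorem diag_rec (s : ℕ) :
    diagPoly (s + 2) + Polynomial.X * diagPoly (s + 1) = diagPoly s + Polynomial.X ^ (s + 2) := by
  rw [diag_ext (s + 2) (s + 3) (by omega), diag_ext (s + 1) (s + 3) (by omega),
    diag_ext s (s + 2) (by omega), Finset.mul_sum, ← Finset.sum_add_distrib]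
  have h : ∀ k ∈ Finset.range (s + 3),
      (Polynomial.C (altJacobsthal (s + 2 + 2 - (k + 1)) (k + 1)) *
        (Polynomial.X : Polynomial ℤ) ^ (s + 2 + 2 - 2 * (k + 1)) +
      Polynomial.X * (Polynomial.C (altJacobsthal (s + 1 + 2 - (k + 1)) (k + 1)) *
        Polynomial.X ^ (s + 1 + 2 - 2 * (k + 1)))) =
      Polynomial.C (altJacobsthal (s + 2 - k) k) * Polynomial.X ^ (s + 2 - 2 * k) := by
    intro k hk
    simp only [Finset.mem_range] at hk
    rw [show s + 2 + 2 - (k + 1) = (s + 2 - k) + 1 by omega,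
      show s + 1 + 2 - (k + 1) = s + 2 - k by omega,
      show s + 2 + 2 - 2 * (k + 1) = s + 2 - 2 * k by omega, altJacobsthal]
    by_cases hk2 : 2 * (k + 1) ≤ s + 3
    · rw [show s + 2 - 2 * k = (s + 1 + 2 - 2 * (k + 1)) + 1 by omega, map_sub]
      ring
    · rw [aj_zero (s + 2 - k) (k + 1) (by omega)]
      simp
  rw [Finset.sum_congr rfl h, Finset.sum_range_succ']
  congr 1
  · simp [altJacobsthal]

theorem diag_zero : diagPoly 0 = 1 := by
  simp [diagPoly, altJacobsthal]

theorem diag_one : diagPoly 1 = 0 := by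
  simp [diagPoly, altJacobsthal]

theorem stmt_18 :
    ((1 - PowerSeries.C (Polynomial.X : Polynomial ℤ) * PowerSeries.X) *
        (1 + PowerSeries.C (Polynomial.X : Polynomial ℤ) * PowerSeries.X - PowerSeries.X ^ 2) *
        PowerSeries.mk (fun s => diagPoly s) : PowerSeries (Polynomial ℤ)) = 1 := by
  have h1 : (1 + PowerSeries.C (Polynomial.X : Polynomial ℤ) * PowerSeries.X - PowerSeries.X ^ 2) *
      PowerSeries.mk (fun s => diagPoly s) =
      PowerSeries.mk (fun s => (Polynomial.X : Polynomial ℤ) ^ s) := by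
    refine PowerSeries.ext fun n => ?_
    rw [sub_mul, add_mul, one_mul, mul_assoc, map_sub, map_add, PowerSeries.coeff_C_mul, pow_two,
      mul_assoc]
    rcases n with _ | _ | n
    · simp [diag_zero]
    · simp [PowerSeries.coeff_succ_X_mul, diag_zero, diag_one]
    · simp only [PowerSeries.coeff_succ_X_mul, PowerSeries.coeff_mk]
      linear_combination diag_rec n
  rw [mul_assoc, h1]
  refine PowerSeries.ext fun n => ?_
  rw [sub_mul, one_mul, mul_assoc, map_sub, PowerSeries.coeff_C_mul]
  rcases n with _ | n
  · simp
  · simp only [PowerSeries.coeff_succ_X_mul, PowerSeries.coeff_mk, PowerSeries.coeff_one]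
    simp [pow_succ']
end
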